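/- arXiv:2309.07830 — 4 statements merged into one kernel-verified Lean document; each statement's English description precedes it below -/
import Mathlib

section
/- There is an orthogonal splitting Λ² = Λ²₇ ⊕ Λ²₂₁ of the space of alternating 2-forms on ℝ⁸ into eigenspaces of the operator ω ↦ ⋆(Φ₀∧ω). Precisely: the eigenspace Λ²₇ = {ω : Tω = 3ω} of T has dimension 7, the eigenspace Λ²₂₁ = {ω : Tω = −ω} has dimension 21, the 28-dimensional space of all alternating 2-forms on ℝ⁸ is the internal direct sum of these two eigenspaces, and the two eigenspaces are orthogonal with respect to the inner product ⟨ω,η⟩ = Σ_{1≤i<j≤8} ω(eᵢ,eⱼ)η(eᵢ,eⱼ). -/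
open scoped BigOperators RealInnerProductSpace

noncomputable section

/-- ℝ⁸ with its Euclidean inner product. -/
abbrev V8 : Type := EuclideanSpace ℝ (Fin 8)

/-- The standard orthonormal basis vectors e₁, …, e₈ of ℝ⁸ (indexed by `Fin 8`). -/
def e (i : Fin 8) : V8 := EuclideanSpace.single i (1 : ℝ)

/-- The alternating 4-form `dxᵢ ∧ dxⱼ ∧ dx_k ∧ dx_l` on ℝ⁸. -/
def dxQ (i j k l : Fin 8) : AlternatingMap ℝ V8 ℝ (Fin 4) :=
  (Matrix.detRowAlternating : AlternatingMap ℝ (Fin 4 → ℝ) ℝ (Fin 4)).compLinearMap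
    (LinearMap.pi fun a : Fin 4 =>
      ((EuclideanSpace.proj (![i, j, k, l] a) : V8 →L[ℝ] ℝ) : V8 →ₗ[ℝ] ℝ))

/-- The standard Cayley form Φ₀ on ℝ⁸. -/
def Phi0 : AlternatingMap ℝ V8 ℝ (Fin 4) :=
  dxQ 0 1 2 3 - dxQ 0 1 4 5 - dxQ 0 1 6 7 - dxQ 0 2 4 6 + dxQ 0 2 5 7 -
    dxQ 0 3 4 7 - dxQ 0 3 5 6 - dxQ 1 2 4 7 - dxQ 1 2 5 6 + dxQ 1 3 4 6 -
    dxQ 1 3 5 7 - dxQ 2 3 4 5 - dxQ 2 3 6 7 + dxQ 4 5 6 7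

/-- Evaluation of an alternating 2-form at a fixed pair of vectors, as a linear functional. -/
def evalSM (v : Fin 2 → V8) : AlternatingMap ℝ V8 ℝ (Fin 2) →ₗ[ℝ] ℝ where
  toFun ω := ω v
  map_add' _ _ := rfl
  map_smul' _ _ := rfl

/-- The alternating 2-form `(x, y) ↦ Φ₀(u, v, x, y)`. -/
def iotaPhi (u v : V8) : AlternatingMap ℝ V8 ℝ (Fin 2) :=
  (Phi0.curryLeft u).curryLeft v

/-- The operator `T : ω ↦ ⋆(Φ₀ ∧ ω)` on alternating 2-forms, given by
`(Tω)(x,y) = Σ_{i<j} ω(eᵢ,eⱼ) Φ₀(eᵢ,eⱼ,x,y)`. -/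
def T : AlternatingMap ℝ V8 ℝ (Fin 2) →ₗ[ℝ] AlternatingMap ℝ V8 ℝ (Fin 2) :=
  ∑ i : Fin 8, ∑ j : Fin 8,
    if i < j then (evalSM ![e i, e j]).smulRight (iotaPhi (e i) (e j)) else 0

/-- The 3-eigenspace Λ²₇ of T. -/
def Lambda7 : Submodule ℝ (AlternatingMap ℝ V8 ℝ (Fin 2)) :=
  LinearMap.ker (T - (3 : ℝ) • LinearMap.id)

/-- The (−1)-eigenspace Λ²₂₁ of T. -/
def Lambda21 : Submodule ℝ (AlternatingMap ℝ V8 ℝ (Fin 2)) :=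
  LinearMap.ker (T + LinearMap.id)

/-- The 28 coordinate planes of ℝ⁸, in seven blocks of four. They are oriented so that `Φ₀` takes
the value `1` on any two distinct planes of one block. -/
def blockPair : Fin 7 → Fin 4 → Fin 8 × Fin 8 :=
  ![![(0, 1), (2, 3), (5, 4), (7, 6)],
    ![(0, 2), (3, 1), (6, 4), (5, 7)],
    ![(0, 3), (1, 2), (7, 4), (6, 5)],
    ![(0, 4), (1, 5), (2, 6), (3, 7)],
    ![(0, 5), (4, 1), (7, 2), (3, 6)],
    ![(0, 6), (1, 7), (4, 2), (5, 3)],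
    ![(0, 7), (6, 1), (2, 5), (4, 3)]]

/-- The integer Kronecker delta. -/
def kron (i j : Fin 8) : ℤ := if i = j then 1 else 0

/-- The integer value of `dxᵢ ∧ dxⱼ` on a pair of standard basis vectors. -/
def intMinor₂ (i j a b : Fin 8) : ℤ := kron a i * kron b j - kron a j * kron b i

/-- The integer value of `dxᵢ ∧ dxⱼ ∧ dx_k ∧ dx_l` on four standard basis vectors, by Laplace
expansion along the first two vectors. -/
def intMinor₄ (i j k l a b c d : Fin 8) : ℤ :=
  intMinor₂ i j a b * intMinor₂ k l c d - intMinor₂ i k a b * intMinor₂ j l c d +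
    intMinor₂ i l a b * intMinor₂ j k c d + intMinor₂ j k a b * intMinor₂ i l c d -
    intMinor₂ j l a b * intMinor₂ i k c d + intMinor₂ k l a b * intMinor₂ i j c d

/-- The integer coefficients of the Cayley form. -/
def intPhi (a b c d : Fin 8) : ℤ :=
  intMinor₄ 0 1 2 3 a b c d - intMinor₄ 0 1 4 5 a b c d - intMinor₄ 0 1 6 7 a b c d -
    intMinor₄ 0 2 4 6 a b c d + intMinor₄ 0 2 5 7 a b c d - intMinor₄ 0 3 4 7 a b c d -
    intMinor₄ 0 3 5 6 a b c d - intMinor₄ 1 2 4 7 a b c d - intMinor₄ 1 2 5 6 a b c d +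
    intMinor₄ 1 3 4 6 a b c d - intMinor₄ 1 3 5 7 a b c d - intMinor₄ 2 3 4 5 a b c d -
    intMinor₄ 2 3 6 7 a b c d + intMinor₄ 4 5 6 7 a b c d

theorem intPhi_swap (a b c d : Fin 8) : intPhi a b c d = -intPhi b a c d := by
  simp only [intPhi, intMinor₄, intMinor₂]
  ring

theorem intPhi_blockPair : ∀ m n : Fin 7, ∀ a b : Fin 4,
    intPhi (blockPair m a).1 (blockPair m a).2 (blockPair n b).1 (blockPair n b).2 =
      if m = n ∧ a ≠ b then 1 else 0 := by
  decide +kernel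

theorem intMinor₂_blockPair : ∀ m n : Fin 7, ∀ a b : Fin 4,
    intMinor₂ (blockPair m a).1 (blockPair m a).2 (blockPair n b).1 (blockPair n b).2 =
      if m = n ∧ a = b then 1 else 0 := by
  decide +kernel

theorem e_apply (i j : Fin 8) : e i j = (kron i j : ℝ) := by
  by_cases h : i = j <;> simp [e, kron, h, eq_comm]

theorem dxQ_apply_e (i j k l a b c d : Fin 8) :
    dxQ i j k l ![e a, e b, e c, e d] = (intMinor₄ i j k l a b c d : ℝ) := by
  have h : dxQ i j k l ![e a, e b, e c, e d] =
      (Matrix.of fun r s => (kron (![a, b, c, d] r) (![i, j, k, l] s) : ℝ)).det := by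
    refine congrArg (Matrix.det (n := Fin 4) (R := ℝ)) ?_
    ext r s
    fin_cases r <;> exact e_apply _ _
  rw [h, Matrix.det_succ_row_zero]
  simp [Fin.sum_univ_succ, Matrix.det_fin_three, Fin.succAbove, intMinor₄, intMinor₂]
  ring

theorem Phi0_apply_e (a b c d : Fin 8) :
    Phi0 ![e a, e b, e c, e d] = (intPhi a b c d : ℝ) := by
  simp [Phi0, intPhi, dxQ_apply_e]

theorem sum_apply_two_form {ι : Type*} (s : Finset ι)
    (ω : ι → AlternatingMap ℝ V8 ℝ (Fin 2)) (v : Fin 2 → V8) :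
    (∑ i ∈ s, ω i) v = ∑ i ∈ s, ω i v :=
  map_sum (evalSM v) ω s

theorem map_e_swap (ω : AlternatingMap ℝ V8 ℝ (Fin 2)) (i j : Fin 8) :
    ω ![e j, e i] = -ω ![e i, e j] := by
  have h := ω.map_swap ![e i, e j] (show (0 : Fin 2) ≠ 1 by decide)
  rw [← h]
  congr 1
  ext k
  fin_cases k <;> rfl

theorem sum_lt_eq_sum_blockPair (G : Fin 8 → Fin 8 → ℝ) (hG : ∀ i j, G i j = G j i) :
    (∑ i : Fin 8, ∑ j : Fin 8, if i < j then G i j else 0) =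
      ∑ m, ∑ a, G (blockPair m a).1 (blockPair m a).2 := by
  simp [Fin.sum_univ_eight, Fin.sum_univ_seven, Fin.sum_univ_four, blockPair]
  rw [hG 5 4, hG 7 6, hG 3 1, hG 6 4, hG 7 4, hG 6 5, hG 4 1, hG 7 2, hG 4 2, hG 5 3, hG 6 1,
    hG 4 3]
  ring

/-- The coordinates of a 2-form on the planes `blockPair m a`. -/
def blockCoord : AlternatingMap ℝ V8 ℝ (Fin 2) →ₗ[ℝ] (Fin 7 → Fin 4 → ℝ) :=
  LinearMap.pi fun m => LinearMap.pi fun a =>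
    evalSM ![e (blockPair m a).1, e (blockPair m a).2]

theorem blockCoord_apply (ω : AlternatingMap ℝ V8 ℝ (Fin 2)) (m : Fin 7) (a : Fin 4) :
    blockCoord ω m a = ω ![e (blockPair m a).1, e (blockPair m a).2] := rfl

theorem exists_blockPair : ∀ i j : Fin 8, i ≠ j →
    ∃ m a, blockPair m a = (i, j) ∨ blockPair m a = (j, i) := by
  decide +kernel

theorem blockCoord_injective : Function.Injective blockCoord := by
  rw [← LinearMap.ker_eq_bot, LinearMap.ker_eq_bot']
  intro ω hω
  refine Module.Basis.ext_alternating (EuclideanSpace.basisFun (Fin 8) ℝ).toBasis fun v hv => ?_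
  obtain ⟨m, a, h⟩ := exists_blockPair (v 0) (v 1) (hv.ne (by decide))
  have hv' : (fun i => (EuclideanSpace.basisFun (Fin 8) ℝ).toBasis (v i)) =
      ![e (v 0), e (v 1)] := by
    ext k : 1
    fin_cases k <;> simp [e]
  have hm : blockCoord ω m a = 0 := by rw [hω]; rfl
  rw [blockCoord_apply] at hm
  rw [hv']
  rcases h with h | h <;> rw [h] at hm
  · simpa using hm
  · rw [map_e_swap] at hm
    simpa using hm

/-- The alternating 2-form `dxᵢ ∧ dxⱼ` on ℝ⁸. -/
def dxB (i j : Fin 8) : AlternatingMap ℝ V8 ℝ (Fin 2) :=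
  (Matrix.detRowAlternating : AlternatingMap ℝ (Fin 2 → ℝ) ℝ (Fin 2)).compLinearMap
    (LinearMap.pi fun a : Fin 2 =>
      ((EuclideanSpace.proj (![i, j] a) : V8 →L[ℝ] ℝ) : V8 →ₗ[ℝ] ℝ))

theorem dxB_apply_e (i j a b : Fin 8) :
    dxB i j ![e a, e b] = (intMinor₂ i j a b : ℝ) := by
  rw [dxB, AlternatingMap.compLinearMap_apply]
  refine (Matrix.det_fin_two _).trans ?_
  simp [e_apply, intMinor₂]

theorem blockCoord_surjective : Function.Surjective blockCoord := by
  intro f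
  refine ⟨∑ m, ∑ a, f m a • dxB (blockPair m a).1 (blockPair m a).2, ?_⟩
  ext n b
  simp [blockCoord_apply, sum_apply_two_form, dxB_apply_e, intMinor₂_blockPair, ite_and]

/-- The coordinates on the planes `blockPair m a` identify 2-forms with `Fin 7 → Fin 4 → ℝ`. -/
def blockEquiv : AlternatingMap ℝ V8 ℝ (Fin 2) ≃ₗ[ℝ] (Fin 7 → Fin 4 → ℝ) :=
  LinearEquiv.ofBijective blockCoord ⟨blockCoord_injective, blockCoord_surjective⟩

theorem blockEquiv_apply (ω : AlternatingMap ℝ V8 ℝ (Fin 2)) (m : Fin 7) (a : Fin 4) :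
    blockEquiv ω m a = ω ![e (blockPair m a).1, e (blockPair m a).2] := rfl

theorem T_apply_e (ω : AlternatingMap ℝ V8 ℝ (Fin 2)) (k l : Fin 8) :
    T ω ![e k, e l] = ∑ i : Fin 8, ∑ j : Fin 8,
      if i < j then ω ![e i, e j] * (intPhi i j k l : ℝ) else 0 := by
  simp only [T, LinearMap.sum_apply, sum_apply_two_form]
  refine Finset.sum_congr rfl fun i _ => Finset.sum_congr rfl fun j _ => ?_
  split_ifs
  · rw [LinearMap.smulRight_apply, AlternatingMap.smul_apply, smul_eq_mul, iotaPhi,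
      AlternatingMap.curryLeft_apply_apply, AlternatingMap.curryLeft_apply_apply, Phi0_apply_e]
    rfl
  · rfl

/-- On each block, `T` acts as the all-ones matrix minus the identity. -/
theorem blockEquiv_T (ω : AlternatingMap ℝ V8 ℝ (Fin 2)) (m : Fin 7) (a : Fin 4) :
    blockEquiv (T ω) m a = ∑ b, blockEquiv ω m b - blockEquiv ω m a := by
  rw [blockEquiv_apply, T_apply_e, sum_lt_eq_sum_blockPair
    (fun i j => ω ![e i, e j] * (intPhi i j _ _ : ℝ))]
  · simp only [intPhi_blockPair, ← blockEquiv_apply]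
    rw [Finset.sum_eq_single m (fun n _ hn => by simp [hn]) (by simp), eq_sub_iff_add_eq,
      ← Finset.sum_erase_add _ _ (Finset.mem_univ a),
      ← Finset.sum_erase_add _ _ (Finset.mem_univ a)]
    simp only [ne_eq, true_and, not_true_eq_false, if_false, Int.cast_zero, mul_zero, add_zero]
    congr 1
    refine Finset.sum_congr rfl fun b hb => ?_
    simp [Finset.ne_of_mem_erase hb]
  · intro i j
    rw [map_e_swap ω i j, intPhi_swap i j, Int.cast_neg, neg_mul, mul_neg]

theorem mem_Lambda7_iff (ω : AlternatingMap ℝ V8 ℝ (Fin 2)) :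
    ω ∈ Lambda7 ↔ ∀ m a, 4 * blockEquiv ω m a = ∑ b, blockEquiv ω m b := by
  rw [Lambda7, LinearMap.mem_ker, LinearMap.sub_apply, sub_eq_zero, ← blockEquiv.injective.eq_iff]
  simp only [funext_iff, blockEquiv_T, LinearMap.smul_apply, LinearMap.id_apply, map_smul,
    Pi.smul_apply, smul_eq_mul]
  refine forall₂_congr fun m a => ?_
  constructor <;> intro h <;> linarith

theorem mem_Lambda21_iff (ω : AlternatingMap ℝ V8 ℝ (Fin 2)) :
    ω ∈ Lambda21 ↔ ∀ m, ∑ b, blockEquiv ω m b = 0 := by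
  rw [Lambda21, LinearMap.mem_ker, LinearMap.add_apply, ← blockEquiv.injective.eq_iff]
  simp only [funext_iff, map_add, map_zero, Pi.add_apply, Pi.zero_apply, blockEquiv_T,
    LinearMap.id_apply, sub_add_cancel]
  exact forall_congr' fun m => forall_const _

/-- The sums of the coordinates of a 2-form over the blocks. -/
def blockSum : AlternatingMap ℝ V8 ℝ (Fin 2) →ₗ[ℝ] (Fin 7 → ℝ) :=
  (LinearMap.pi fun m => ∑ a, LinearMap.proj a ∘ₗ LinearMap.proj m) ∘ₗ blockEquiv.toLinearMap

theorem blockSum_apply (ω : AlternatingMap ℝ V8 ℝ (Fin 2)) (m : Fin 7) :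
    blockSum ω m = ∑ a, blockEquiv ω m a := by
  simp [blockSum]

theorem ker_blockSum : LinearMap.ker blockSum = Lambda21 := by
  ext ω
  simp [mem_Lambda21_iff, funext_iff, blockSum_apply]

theorem blockSum_surjective : Function.Surjective blockSum := by
  intro f
  refine ⟨blockEquiv.symm fun m _ => f m / 4, ?_⟩
  ext m
  simp [blockSum_apply]
  ring

theorem finrank_two_forms : Module.finrank ℝ (AlternatingMap ℝ V8 ℝ (Fin 2)) = 28 := by
  rw [blockEquiv.finrank_eq, Module.finrank_pi_fintype]
  simp

theorem Lambda7_inf_Lambda21 : Lambda7 ⊓ Lambda21 = ⊥ := by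
  rw [eq_bot_iff]
  rintro ω ⟨h7, h21⟩
  rw [SetLike.mem_coe, mem_Lambda7_iff] at h7
  rw [SetLike.mem_coe, mem_Lambda21_iff] at h21
  rw [Submodule.mem_bot, ← blockEquiv.map_eq_zero_iff]
  ext m a
  have := h7 m a
  rw [h21 m] at this
  simpa using this

theorem Lambda7_sup_Lambda21 : Lambda7 ⊔ Lambda21 = ⊤ := by
  rw [eq_top_iff]
  intro ω _
  refine Submodule.mem_sup.2 ⟨blockEquiv.symm fun m _ => (∑ b, blockEquiv ω m b) / 4, ?_,
    ω - blockEquiv.symm fun m _ => (∑ b, blockEquiv ω m b) / 4, ?_, by abel⟩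
  · rw [mem_Lambda7_iff]
    intro m a
    simp
  · rw [mem_Lambda21_iff]
    intro m
    simp
    ring

theorem finrank_Lambda21 : Module.finrank ℝ Lambda21 = 21 := by
  have : Module.Finite ℝ (AlternatingMap ℝ V8 ℝ (Fin 2)) := Module.Finite.equiv blockEquiv.symm
  have h := blockSum.finrank_range_add_finrank_ker
  rw [LinearMap.range_eq_top.2 blockSum_surjective, ker_blockSum, finrank_two_forms,
    finrank_top, Module.finrank_fin_fun] at h
  omega

theorem finrank_Lambda7 : Module.finrank ℝ Lambda7 = 7 := by
  have : Module.Finite ℝ (AlternatingMap ℝ V8 ℝ (Fin 2)) := Module.Finite.equiv blockEquiv.symm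
  have h := Submodule.finrank_sup_add_finrank_inf_eq Lambda7 Lambda21
  rw [Lambda7_sup_Lambda21, Lambda7_inf_Lambda21, finrank_top, finrank_bot, finrank_two_forms,
    finrank_Lambda21] at h
  omega

theorem Lambda7_orthogonal_Lambda21 (ω : AlternatingMap ℝ V8 ℝ (Fin 2)) (hω : ω ∈ Lambda7)
    (η : AlternatingMap ℝ V8 ℝ (Fin 2)) (hη : η ∈ Lambda21) :
    (∑ i : Fin 8, ∑ j : Fin 8, if i < j then ω ![e i, e j] * η ![e i, e j] else 0) = 0 := by
  rw [sum_lt_eq_sum_blockPair (fun i j => ω ![e i, e j] * η ![e i, e j]) fun i j => by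
    rw [map_e_swap ω i j, map_e_swap η i j, neg_mul_neg]]
  refine Finset.sum_eq_zero fun m _ => ?_
  simp only [← blockEquiv_apply]
  have h (a : Fin 4) : blockEquiv ω m a = (∑ b, blockEquiv ω m b) / 4 := by
    rw [← (mem_Lambda7_iff ω).1 hω m a]
    ring
  rw [Finset.sum_congr rfl fun a _ => congrArg (· * blockEquiv η m a) (h a), ← Finset.mul_sum,
    (mem_Lambda21_iff η).1 hη m, mul_zero]

/-- **Orthogonal splitting Λ² = Λ²₇ ⊕ Λ²₂₁.**  The 3-eigenspace of `T = ⋆(Φ₀∧·)` has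
dimension 7, the (−1)-eigenspace has dimension 21, the 28-dimensional space of alternating
2-forms on ℝ⁸ is their internal direct sum, and the two eigenspaces are orthogonal for the
inner product `⟨ω,η⟩ = Σ_{i<j} ω(eᵢ,eⱼ) η(eᵢ,eⱼ)`. -/
theorem two_form_splitting :
    Module.finrank ℝ Lambda7 = 7 ∧
    Module.finrank ℝ Lambda21 = 21 ∧
    Module.finrank ℝ (AlternatingMap ℝ V8 ℝ (Fin 2)) = 28 ∧
    Lambda7 ⊔ Lambda21 = ⊤ ∧ Lambda7 ⊓ Lambda21 = ⊥ ∧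
    ∀ ω ∈ Lambda7, ∀ η ∈ Lambda21,
      (∑ i : Fin 8, ∑ j : Fin 8,
        if i < j then ω ![e i, e j] * η ![e i, e j] else 0) = 0 :=
  ⟨finrank_Lambda7, finrank_Lambda21, finrank_two_forms, Lambda7_sup_Lambda21, Lambda7_inf_Lambda21,
    Lambda7_orthogonal_Lambda21⟩
end
end

section
/- Cayley inequality: for every orthonormal quadruple of vectors f₁, f₂, f₃, f₄ in ℝ⁸, one has Φ₀(f₁,f₂,f₃,f₄) ≤ 1. -/
open scoped BigOperators RealInnerProductSpace

noncomputable section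

/-- The `2 × 2` minor of the pair `(a, b)` in the columns `i, j`. -/
def minor (a b : V8) (i j : Fin 8) : ℝ := a i * b j - a j * b i

/-- The imaginary part of the octonion product of `a` (conjugated) and `b`: the seven 2-forms
`dx₁ ∧ dxⱼ + ι_{eⱼ} ι_{e₁} Φ₀` evaluated at `(a, b)`. -/
def crossProd (a b : V8) : Fin 7 → ℝ :=
  ![minor a b 0 1 + minor a b 2 3 - minor a b 4 5 - minor a b 6 7,
    minor a b 0 2 - minor a b 1 3 - minor a b 4 6 + minor a b 5 7,
    minor a b 0 3 + minor a b 1 2 - minor a b 4 7 - minor a b 5 6,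
    minor a b 0 4 + minor a b 1 5 + minor a b 2 6 + minor a b 3 7,
    minor a b 0 5 - minor a b 1 4 - minor a b 2 7 + minor a b 3 6,
    minor a b 0 6 + minor a b 1 7 - minor a b 2 4 - minor a b 3 5,
    minor a b 0 7 - minor a b 1 6 + minor a b 2 5 - minor a b 3 4]

lemma V8.inner_eq (a b : V8) : inner ℝ a b =
    a 0 * b 0 + a 1 * b 1 + a 2 * b 2 + a 3 * b 3 + a 4 * b 4 + a 5 * b 5 + a 6 * b 6 +
      a 7 * b 7 := by
  simp [PiLp.inner_apply, Fin.sum_univ_eight, mul_comm]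

lemma dxQ_apply (i j k l : Fin 8) (f : Fin 4 → V8) : dxQ i j k l f =
    minor (f 0) (f 1) i j * minor (f 2) (f 3) k l - minor (f 0) (f 1) i k * minor (f 2) (f 3) j l +
      minor (f 0) (f 1) i l * minor (f 2) (f 3) j k + minor (f 0) (f 1) j k * minor (f 2) (f 3) i l -
      minor (f 0) (f 1) j l * minor (f 2) (f 3) i k +
      minor (f 0) (f 1) k l * minor (f 2) (f 3) i j := by
  change Matrix.det (Matrix.of fun r c : Fin 4 => f r (![i, j, k, l] c)) = _
  simp [Matrix.det_succ_row_zero, Fin.sum_univ_succ, Fin.succAbove, minor]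
  ring

/-- `|a ∧ b|² = |a × b|²` for the 2-fold cross product. -/
lemma crossProd_dotProduct_self (a b : V8) : crossProd a b ⬝ᵥ crossProd a b =
    inner ℝ a a * inner ℝ b b - inner ℝ a b ^ 2 := by
  simp only [V8.inner_eq, crossProd, minor, dotProduct, Fin.sum_univ_seven]
  simp
  ring

/-- `Φ₀` in terms of the 2-fold cross product. -/
lemma Phi0_apply (f : Fin 4 → V8) : Phi0 f =
    crossProd (f 0) (f 1) ⬝ᵥ crossProd (f 2) (f 3) -
      (inner ℝ (f 0) (f 2) * inner ℝ (f 1) (f 3) - inner ℝ (f 0) (f 3) * inner ℝ (f 1) (f 2)) := by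
  simp only [Phi0, AlternatingMap.sub_apply, AlternatingMap.add_apply, dxQ_apply]
  simp only [V8.inner_eq, crossProd, dotProduct, Fin.sum_univ_seven]
  simp [minor]
  ring

/-- **Cayley inequality:** for every orthonormal quadruple `f₁, f₂, f₃, f₄` in ℝ⁸ one has
`Φ₀(f₁,f₂,f₃,f₄) ≤ 1`. -/
theorem cayley_inequality (f : Fin 4 → V8) (hf : Orthonormal ℝ f) :
    Phi0 f ≤ 1 := by
  have h (i j : Fin 4) : inner ℝ (f i) (f j) = if i = j then (1 : ℝ) else 0 :=
    orthonormal_iff_ite.mp hf i j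
  have h01 := crossProd_dotProduct_self (f 0) (f 1)
  have h23 := crossProd_dotProduct_self (f 2) (f 3)
  have key : 0 ≤ (crossProd (f 0) (f 1) - crossProd (f 2) (f 3)) ⬝ᵥ
      (crossProd (f 0) (f 1) - crossProd (f 2) (f 3)) :=
    Finset.sum_nonneg fun _ _ => mul_self_nonneg _
  rw [sub_dotProduct, dotProduct_sub, dotProduct_sub,
    dotProduct_comm (crossProd (f 2) (f 3)) (crossProd (f 0) (f 1))] at key
  rw [Phi0_apply]
  simp [h, hf.1] at h01 h23 ⊢
  linarith
end
end

section
/- Complex 2-planes are Cayley planes: let J : ℝ⁸ → ℝ⁸ be the linear complex structure determined by Je₁ = e₂, Je₂ = −e₁, Je₃ = e₄, Je₄ = −e₃, Je₅ = −e₆, Je₆ = e₅, Je₇ = −e₈, Je₈ = e₇. Then for all unit vectors u, v ∈ ℝ⁸ such that v is orthogonal to both u and Ju, one has Φ₀(u, Ju, v, Jv) = 1. In particular every J-complex 2-dimensional subspace of ℝ⁸ ≅ ℂ⁴ is calibrated by the Cayley form Φ₀. -/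
open scoped BigOperators RealInnerProductSpace

noncomputable section

/-- The orthogonal complex structure J on ℝ⁸ ≅ ℂ⁴ determined by
  Je₁ = e₂, Je₂ = −e₁, Je₃ = e₄, Je₄ = −e₃, Je₅ = −e₆, Je₆ = e₅, Je₇ = −e₈, Je₈ = e₇. -/
def J (x : V8) : V8 :=
  (WithLp.equiv 2 (Fin 8 → ℝ)).symm ![-x 1, x 0, -x 3, x 2, x 5, -x 4, x 7, -x 6]

theorem dxQ_apply_s7 (i j k l : Fin 8) (a b c d : V8) :
    dxQ i j k l ![a, b, c, d] =
      Matrix.det !![a i, a j, a k, a l; b i, b j, b k, b l; c i, c j, c k, c l;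
        d i, d j, d k, d l] := by
  rw [dxQ, AlternatingMap.compLinearMap_apply]
  change Matrix.det _ = Matrix.det _
  congr 1
  ext r s
  fin_cases r <;> fin_cases s <;> rfl

theorem det_fin_four (M : Matrix (Fin 4) (Fin 4) ℝ) :
    M.det =
      (M 0 0 * M 1 1 - M 0 1 * M 1 0) * (M 2 2 * M 3 3 - M 2 3 * M 3 2) -
      (M 0 0 * M 1 2 - M 0 2 * M 1 0) * (M 2 1 * M 3 3 - M 2 3 * M 3 1) +
      (M 0 0 * M 1 3 - M 0 3 * M 1 0) * (M 2 1 * M 3 2 - M 2 2 * M 3 1) +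
      (M 0 1 * M 1 2 - M 0 2 * M 1 1) * (M 2 0 * M 3 3 - M 2 3 * M 3 0) -
      (M 0 1 * M 1 3 - M 0 3 * M 1 1) * (M 2 0 * M 3 2 - M 2 2 * M 3 0) +
      (M 0 2 * M 1 3 - M 0 3 * M 1 2) * (M 2 0 * M 3 1 - M 2 1 * M 3 0) := by
  simp [Matrix.det_succ_row_zero, Fin.sum_univ_succ, Fin.succAbove]
  ring

theorem inner_eq_sum (x y : V8) :
    ⟪x, y⟫ = x 0 * y 0 + x 1 * y 1 + x 2 * y 2 + x 3 * y 3 + x 4 * y 4 + x 5 * y 5 +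
      x 6 * y 6 + x 7 * y 7 := by
  simp [PiLp.inner_apply, Fin.sum_univ_eight, mul_comm]

/-- On a pair of complex lines, `Phi0` is the Gram determinant of the standard Hermitian form. -/
theorem Phi0_apply_J (u v : V8) :
    Phi0 ![u, J u, v, J v] = ‖u‖ ^ 2 * ‖v‖ ^ 2 - ⟪u, v⟫ ^ 2 - ⟪J u, v⟫ ^ 2 := by
  simp only [← real_inner_self_eq_norm_sq, inner_eq_sum, Phi0, AlternatingMap.add_apply,
    AlternatingMap.sub_apply, dxQ_apply_s7, det_fin_four]
  simp only [J, WithLp.equiv_symm_apply, Matrix.of_apply, Matrix.cons_val]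
  ring

/-- **Complex 2-planes are Cayley planes:** for unit vectors `u, v` with `v` orthogonal to
both `u` and `Ju`, one has `Φ₀(u, Ju, v, Jv) = 1`; so every J-complex 2-dimensional
subspace of ℝ⁸ ≅ ℂ⁴ is calibrated by Φ₀. -/
theorem complex_plane_is_cayley (u v : V8) (hu : ‖u‖ = 1) (hv : ‖v‖ = 1)
    (huv : ⟪u, v⟫ = 0) (hJuv : ⟪J u, v⟫ = 0) :
    Phi0 ![u, J u, v, J v] = 1 := by
  rw [Phi0_apply_J, hu, hv, huv, hJuv]
  norm_num
end
end

section
/- Liouville theorem with sublinear growth on ℝ⁴: let f : EuclideanSpace ℝ (Fin 4) → ℝ be a smooth harmonic function, i.e. Σ_{i=1}^{4} ∂²f/∂xᵢ²(x) = 0 for every x (the sum over the standard orthonormal basis of the second derivatives of f, expressed via the second iterated Fréchet derivative, vanishes identically). If there exist constants C ≥ 0 and λ < 1 such that |f(x)| ≤ C(1 + ‖x‖)^λ for all x, then f is constant. -/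
open MeasureTheory Filter Topology Metric

theorem hasDerivAt_max_zero_sq (t : ℝ) :
    HasDerivAt (fun s : ℝ => max 0 s ^ 2) (2 * max 0 t) t := by
  rcases lt_trichotomy t 0 with ht | rfl | ht
  · rw [max_eq_left ht.le]
    have h : (fun s : ℝ => max 0 s ^ 2) =ᶠ[𝓝 t] fun _ => 0 := by
      filter_upwards [Iio_mem_nhds ht] with s hs
      simp [max_eq_left (Set.mem_Iio.1 hs).le]
    simpa using (hasDerivAt_const t (0 : ℝ)).congr_of_eventuallyEq h
  · rw [hasDerivAt_iff_isLittleO]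
    have h : (fun s : ℝ => s ^ 2) =o[𝓝 0] fun s : ℝ => s := by
      simpa using Asymptotics.isLittleO_pow_pow (𝕜 := ℝ) (m := 1) (n := 2) (by norm_num)
    refine (Asymptotics.IsBigO.of_bound 1 (Eventually.of_forall fun s => ?_)).trans_isLittleO
      (by simpa using h)
    rcases le_total 0 s with hs | hs <;> simp [hs, sq_nonneg]
  · rw [max_eq_right ht.le]
    have h : (fun s : ℝ => max 0 s ^ 2) =ᶠ[𝓝 t] fun s => s ^ 2 := by
      filter_upwards [Ioi_mem_nhds ht] with s hs
      rw [max_eq_right (Set.mem_Ioi.1 hs).le]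
    simpa using (hasDerivAt_pow 2 t).congr_of_eventuallyEq h

section

variable {E : Type*} [NormedAddCommGroup E]

/-- The radial bump `z ↦ max 0 (1 - ‖z‖²)`. -/
def radialBump (z : E) : ℝ := max 0 (1 - ‖z‖ ^ 2)

theorem continuous_radialBump : Continuous (radialBump : E → ℝ) := by
  unfold radialBump; fun_prop

theorem radialBump_nonneg (z : E) : 0 ≤ radialBump z := le_max_left _ _

theorem radialBump_eq_zero {z : E} (hz : 1 ≤ ‖z‖) : radialBump z = 0 :=
  max_eq_left (by nlinarith)

theorem abs_radialBump_sub_le (a b : E) :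
    |radialBump a - radialBump b| ≤ (‖a‖ + ‖b‖) * ‖a - b‖ := by
  have h1 : |radialBump a - radialBump b| ≤ |(1 - ‖a‖ ^ 2) - (1 - ‖b‖ ^ 2)| :=
    (abs_max_sub_max_le_max 0 (1 - ‖a‖ ^ 2) 0 (1 - ‖b‖ ^ 2)).trans (by simp)
  have h2 : (1 - ‖a‖ ^ 2) - (1 - ‖b‖ ^ 2) = (‖a‖ + ‖b‖) * (‖b‖ - ‖a‖) := by ring
  have h3 : 0 ≤ ‖a‖ + ‖b‖ := by positivity
  rw [h2, abs_mul, abs_of_nonneg h3, abs_sub_comm ‖b‖] at h1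
  exact h1.trans (mul_le_mul_of_nonneg_left (abs_norm_sub_norm_le a b) h3)

variable [InnerProductSpace ℝ E]

theorem hasFDerivAt_radialBump_sq (z : E) :
    HasFDerivAt (fun w : E => radialBump w ^ 2) ((-4 * radialBump z) • innerSL ℝ z) z := by
  have h1 : HasFDerivAt (fun w : E => 1 - ‖w‖ ^ 2) (-(2 • innerSL ℝ z)) z :=
    (hasStrictFDerivAt_norm_sq z).hasFDerivAt.const_sub 1
  have h2 := (hasDerivAt_max_zero_sq (1 - ‖z‖ ^ 2)).comp_hasFDerivAt z h1
  refine h2.congr_fderiv ?_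
  ext v
  simp [radialBump]
  ring

variable [FiniteDimensional ℝ E]

theorem hasCompactSupport_radialBump : HasCompactSupport (radialBump : E → ℝ) :=
  HasCompactSupport.intro (isCompact_closedBall (0 : E) 1) fun z hz =>
    radialBump_eq_zero (by simpa using (not_le.1 (mt mem_closedBall_zero_iff.2 hz)).le)

variable [MeasurableSpace E] [BorelSpace E]

theorem integral_radialBump_pos : 0 < ∫ z : E, radialBump z :=
  continuous_radialBump.integral_pos_of_hasCompactSupport_nonneg_nonzero
    hasCompactSupport_radialBump radialBump_nonneg (x := 0) (by simp [radialBump])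

theorem integrable_mul_radialBump {g : E → ℝ} (hg : Continuous g) :
    Integrable fun z => g z * radialBump z :=
  (hg.mul continuous_radialBump).integrable_of_hasCompactSupport
    hasCompactSupport_radialBump.mul_left

variable {ι : Type*} [Fintype ι] (b : OrthonormalBasis ι ℝ E) {f : E → ℝ}

theorem integral_fderiv_mul_radialBump_eq_zero (hf : ContDiff ℝ 2 f)
    (hharm : ∀ x, ∑ i, fderiv ℝ (fderiv ℝ f) x (b i) (b i) = 0) (x : E) (r : ℝ) :
    ∫ z, fderiv ℝ f (x + r • z) z * radialBump z = 0 := by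
  have hf' : ContDiff ℝ 1 (fderiv ℝ f) := hf.fderiv_right (by norm_num)
  have hc' : Continuous (fderiv ℝ f) := hf'.continuous
  have hc'' : Continuous (fderiv ℝ (fderiv ℝ f)) := hf'.continuous_fderiv (by norm_num)
  have hbc := continuous_radialBump (E := E)
  have hd (i : ι) (z : E) : HasFDerivAt (fun z => fderiv ℝ f (x + r • z) (b i))
      ((ContinuousLinearMap.apply ℝ ℝ (b i)).comp
        ((fderiv ℝ (fderiv ℝ f) (x + r • z)).comp (r • ContinuousLinearMap.id ℝ E))) z := by
    have h1 : HasFDerivAt (fun z : E => x + r • z) (r • ContinuousLinearMap.id ℝ E) z :=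
      ((hasFDerivAt_id z).const_smul r).const_add x
    have h2 := (hf'.differentiable (by norm_num) (x + r • z)).hasFDerivAt
    exact (ContinuousLinearMap.apply ℝ ℝ (b i)).hasFDerivAt.comp z (h2.comp z h1)
  have hparts (i : ι) :
      ∫ z, fderiv ℝ f (x + r • z) (b i) * (-4 * radialBump z * inner ℝ z (b i)) =
        -∫ z, r * fderiv ℝ (fderiv ℝ f) (x + r • z) (b i) (b i) * radialBump z ^ 2 := by
    have key := integral_bilinear_hasFDerivAt_right_eq_neg_left_of_integrable
      (μ := (volume : Measure E)) (B := ContinuousLinearMap.mul ℝ ℝ) (v := b i)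
      (f := fun z => fderiv ℝ f (x + r • z) (b i)) (g := fun w : E => radialBump w ^ 2)
      (g' := fun z => (-4 * radialBump z) • innerSL ℝ z)
      ?_ ?_ ?_ (fun z _ => hd i z) (fun z _ => hasFDerivAt_radialBump_sq z)
    · simpa using key
    · refine (integrable_mul_radialBump (g := fun z =>
        r * fderiv ℝ (fderiv ℝ f) (x + r • z) (b i) (b i) * radialBump z) (by fun_prop)).congr
        (Eventually.of_forall fun z => ?_)
      simp; ring
    · refine (integrable_mul_radialBump (g := fun z =>
        fderiv ℝ f (x + r • z) (b i) * (-4 * inner ℝ z (b i))) (by fun_prop)).congr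
        (Eventually.of_forall fun z => ?_)
      simp; ring
    · refine (integrable_mul_radialBump (g := fun z =>
        fderiv ℝ f (x + r • z) (b i) * radialBump z) (by fun_prop)).congr
        (Eventually.of_forall fun z => ?_)
      simp; ring
  have hexp (z : E) : fderiv ℝ f (x + r • z) z * radialBump z =
      -(1 / 4) * ∑ i, fderiv ℝ f (x + r • z) (b i) * (-4 * radialBump z * inner ℝ z (b i)) := by
    have h : fderiv ℝ f (x + r • z) z =
        ∑ i, inner ℝ (b i) z * fderiv ℝ f (x + r • z) (b i) := by
      conv_lhs => arg 2; rw [← b.sum_repr' z]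
      simp
    rw [h, Finset.sum_mul, Finset.mul_sum]
    refine Finset.sum_congr rfl fun i _ => ?_
    rw [real_inner_comm]
    ring
  simp_rw [hexp]
  rw [integral_const_mul, integral_finsetSum, Finset.sum_congr rfl fun i _ => hparts i,
    Finset.sum_neg_distrib, ← integral_finsetSum]
  · simp_rw [← Finset.sum_mul, ← Finset.mul_sum, hharm]
    simp
  · intro i _
    refine (integrable_mul_radialBump (g := fun z =>
      r * fderiv ℝ (fderiv ℝ f) (x + r • z) (b i) (b i) * radialBump z) (by fun_prop)).congr
      (Eventually.of_forall fun z => ?_)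
    simp; ring
  · intro i _
    refine (integrable_mul_radialBump (g := fun z =>
      fderiv ℝ f (x + r • z) (b i) * (-4 * inner ℝ z (b i))) (by fun_prop)).congr
      (Eventually.of_forall fun z => ?_)
    simp; ring

theorem hasDerivAt_integral_mul_radialBump (hf : ContDiff ℝ 1 f) (x : E) (r : ℝ) :
    HasDerivAt (fun r : ℝ => ∫ z, f (x + r • z) * radialBump z)
      (∫ z, fderiv ℝ f (x + r • z) z * radialBump z) r := by
  have hc := hf.continuous
  have hc' : Continuous (fderiv ℝ f) := hf.continuous_fderiv (by norm_num)
  obtain ⟨M, hM⟩ := ((isCompact_closedBall r 1).prod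
    (isCompact_closedBall (0 : E) 1)).exists_bound_of_continuousOn
    (f := fun p : ℝ × E => fderiv ℝ f (x + p.1 • p.2) p.2) (by fun_prop)
  refine (hasDerivAt_integral_of_dominated_loc_of_deriv_le (s := closedBall r 1)
    (bound := fun z => M * radialBump z)
    (F' := fun s z => fderiv ℝ f (x + s • z) z * radialBump z)
    (closedBall_mem_nhds r one_pos) (Eventually.of_forall fun s => ?_) ?_ ?_
    (Eventually.of_forall fun z s hs => ?_) ?_ (Eventually.of_forall fun z s _ => ?_)).2
  · exact (integrable_mul_radialBump (by fun_prop)).aestronglyMeasurable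
  · exact integrable_mul_radialBump (by fun_prop)
  · exact (integrable_mul_radialBump (by fun_prop)).aestronglyMeasurable
  · rw [norm_mul, Real.norm_of_nonneg (radialBump_nonneg z)]
    rcases le_total ‖z‖ 1 with hz | hz
    · exact mul_le_mul_of_nonneg_right
        (hM (s, z) ⟨hs, mem_closedBall_zero_iff.2 hz⟩) (radialBump_nonneg z)
    · simp [radialBump_eq_zero hz]
  · exact integrable_mul_radialBump continuous_const
  · have h1 : HasDerivAt (fun s : ℝ => x + s • z) z s := by
      simpa using ((hasDerivAt_id s).smul_const z).const_add x
    exact ((hf.differentiable (by norm_num) (x + s • z)).hasFDerivAt.comp_hasDerivAt s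
      h1).mul_const _

/-- Weighted mean value property of harmonic functions. -/
theorem integral_mul_radialBump_eq (hf : ContDiff ℝ 2 f)
    (hharm : ∀ x, ∑ i, fderiv ℝ (fderiv ℝ f) x (b i) (b i) = 0) (x : E) (r : ℝ) :
    ∫ z, f (x + r • z) * radialBump z = f x * ∫ z : E, radialBump z := by
  have h (s : ℝ) := hasDerivAt_integral_mul_radialBump (hf.of_le (by norm_num)) x s
  have := is_const_of_deriv_eq_zero (fun s => (h s).differentiableAt)
    (fun s => (h s).deriv.trans (integral_fderiv_mul_radialBump_eq_zero b hf hharm x s)) r 0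
  simpa [integral_const_mul] using this

theorem sub_mul_integral_radialBump (hf : ContDiff ℝ 2 f)
    (hharm : ∀ x, ∑ i, fderiv ℝ (fderiv ℝ f) x (b i) (b i) = 0) (x v : E) {r : ℝ} (hr : 0 < r) :
    (f (x + v) - f x) * ∫ z : E, radialBump z =
      ∫ z, f (x + r • z) * (radialBump (z - r⁻¹ • v) - radialBump z) := by
  have hc := hf.continuous
  have h1 : ∫ z, f (x + r • z) * radialBump (z - r⁻¹ • v) =
      f (x + v) * ∫ z : E, radialBump z := by
    rw [← integral_mul_radialBump_eq b hf hharm (x + v) r,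
      ← integral_add_right_eq_self _ (r⁻¹ • v)]
    congr 1 with z
    rw [add_sub_cancel_right, smul_add, smul_inv_smul₀ hr.ne']
    congr 2
    abel
  have hi : Integrable fun z => f (x + r • z) * radialBump (z - r⁻¹ • v) := by
    have := (integrable_mul_radialBump (g := fun z => f (x + r • (z + r⁻¹ • v)))
      (by fun_prop)).comp_sub_right (r⁻¹ • v)
    simpa using this
  simp_rw [mul_sub]
  rw [integral_sub hi (integrable_mul_radialBump (by fun_prop)), h1,
    integral_mul_radialBump_eq b hf hharm x r, sub_mul]

theorem abs_sub_mul_integral_radialBump_le (hf : ContDiff ℝ 2 f)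
    (hharm : ∀ x, ∑ i, fderiv ℝ (fderiv ℝ f) x (b i) (b i) = 0) (x v : E) {r K : ℝ} (hr : 0 < r)
    (hv : ‖v‖ ≤ r) (hK : ∀ w, ‖w‖ ≤ ‖x‖ + 2 * r → |f w| ≤ K) :
    |f (x + v) - f x| * ∫ z : E, radialBump z ≤
      K * (5 * (r⁻¹ * ‖v‖)) * volume.real (closedBall (0 : E) 2) := by
  have hvr : ‖r⁻¹ • v‖ = r⁻¹ * ‖v‖ := by
    rw [norm_smul, Real.norm_of_nonneg (inv_nonneg.2 hr.le)]
  have hvr1 : ‖r⁻¹ • v‖ ≤ 1 := by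
    rw [hvr, inv_mul_le_iff₀ hr]; simpa using hv
  have hpos := (integral_radialBump_pos (E := E)).le
  rw [← abs_of_nonneg hpos, ← abs_mul, sub_mul_integral_radialBump b hf hharm x v hr,
    ← setIntegral_eq_integral_of_forall_compl_eq_zero (s := closedBall (0 : E) 2)]
  · rw [← Real.norm_eq_abs]
    refine norm_setIntegral_le_of_norm_le_const measure_closedBall_lt_top fun z hz => ?_
    rw [mem_closedBall_zero_iff] at hz
    have h1 : |f (x + r • z)| ≤ K := hK _ <| by
      refine (norm_add_le _ _).trans ?_
      rw [norm_smul, Real.norm_of_nonneg hr.le]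
      nlinarith
    have h2 := abs_radialBump_sub_le (z - r⁻¹ • v) z
    have h3 : ‖z - r⁻¹ • v - z‖ = r⁻¹ * ‖v‖ := by
      rw [← hvr, ← norm_neg]; congr 1; abel
    have h4 := norm_sub_le z (r⁻¹ • v)
    rw [h3] at h2
    rw [Real.norm_eq_abs, abs_mul]
    refine mul_le_mul h1 (h2.trans ?_) (abs_nonneg _) ((abs_nonneg _).trans h1)
    have : 0 ≤ r⁻¹ * ‖v‖ := by positivity
    gcongr
    linarith
  · intro z hz
    rw [mem_closedBall_zero_iff, not_le] at hz
    have h5 := norm_sub_norm_le z (r⁻¹ • v)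
    rw [radialBump_eq_zero (by linarith), radialBump_eq_zero (by linarith)]
    simp

/-- Liouville's theorem for harmonic functions of sublinear growth. -/
theorem eq_of_harmonic_of_sublinear (hf : ContDiff ℝ 2 f)
    (hharm : ∀ x, ∑ i, fderiv ℝ (fderiv ℝ f) x (b i) (b i) = 0) {C p : ℝ} (hC : 0 ≤ C)
    (hp₀ : 0 ≤ p) (hp : p < 1) (hgrowth : ∀ x, |f x| ≤ C * (1 + ‖x‖) ^ p) (x y : E) :
    f x = f y := by
  set I := ∫ z : E, radialBump z with hI
  have hIpos : 0 < I := integral_radialBump_pos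
  set A := C * 3 ^ p * (5 * ‖x - y‖) * volume.real (closedBall (0 : E) 2) with hA
  have hlim : Tendsto (fun r : ℝ => A * r ^ (-(1 - p))) atTop (𝓝 0) := by
    simpa using (tendsto_rpow_neg_atTop (sub_pos.2 hp)).const_mul A
  have hle : |f x - f y| * I ≤ 0 := by
    refine ge_of_tendsto hlim ?_
    filter_upwards [eventually_ge_atTop (1 + ‖y‖), eventually_ge_atTop ‖x - y‖] with r h1 h2
    have hr : 0 < r := by linarith [norm_nonneg y]
    have hb := abs_sub_mul_integral_radialBump_le b hf hharm y (x - y) (K := C * (3 * r) ^ p)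
      hr h2 fun w hw => (hgrowth w).trans (by gcongr; linarith)
    rw [add_sub_cancel] at hb
    refine hb.trans (le_of_eq ?_)
    rw [Real.mul_rpow (by norm_num) hr.le, neg_sub, Real.rpow_sub_one hr.ne', hA]
    ring
  have h0 : |f x - f y| ≤ 0 := nonpos_of_mul_nonpos_left hle hIpos
  exact sub_eq_zero.1 (abs_nonpos_iff.1 h0)

end

/-- **Liouville theorem with sublinear growth on ℝ⁴:** a smooth harmonic function
`f : ℝ⁴ → ℝ` (the sum over the standard orthonormal basis of its second derivatives
vanishes identically) satisfying `|f(x)| ≤ C(1 + ‖x‖)^λ` for some `C ≥ 0` and `λ < 1`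
is constant. -/
theorem liouville_sublinear (f : EuclideanSpace ℝ (Fin 4) → ℝ)
    (hf : ContDiff ℝ (⊤ : ℕ∞) f)
    (hharm : ∀ x : EuclideanSpace ℝ (Fin 4),
      ∑ i : Fin 4, iteratedFDeriv ℝ 2 f x
        ![EuclideanSpace.single i (1 : ℝ), EuclideanSpace.single i (1 : ℝ)] = 0)
    (C lam : ℝ) (hC : 0 ≤ C) (hlam : lam < 1)
    (hgrowth : ∀ x, |f x| ≤ C * (1 + ‖x‖) ^ lam) :
    ∀ x y, f x = f y := by
  refine eq_of_harmonic_of_sublinear (EuclideanSpace.basisFun (Fin 4) ℝ)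
    (hf.of_le (WithTop.coe_le_coe.2 le_top)) (fun x => ?_) hC (le_max_right lam 0)
    (max_lt hlam one_pos) fun x => (hgrowth x).trans ?_
  · simpa [iteratedFDeriv_two_apply] using hharm x
  · gcongr
    · linarith [norm_nonneg x]
    · exact le_max_left _ _
end
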